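/- Assume n > 0. Then any two irreducible r-markings on the curve Γ are equivalent, i.e., one can be obtained from the other by a finite sequence of D-moves and T-moves. -/

import Mathlib

namespace SeveriMarkings

/-- Components of the curve Γ: `L_1, …, L_d` (left) and `F_1, …, F_k` (right). -/
abbrev Comp (d k : ℕ) := Sum (Fin d) (Fin k)

/-- Nodes (edges of the multigraph `G(n,d,k)`): `n` edges between `L_i` and `L_j` for `i < j`,
and one edge between each `L_i` and each `F_j`. -/
abbrev Node (n d k : ℕ) :=
  Sum (({p : Fin d × Fin d // p.1 < p.2}) × Fin n) (Fin d × Fin k)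

/-- The two endpoints of a node. -/
def ends {n d k : ℕ} : Node n d k → Comp d k × Comp d k
  | Sum.inl e => (Sum.inl e.1.1.1, Sum.inl e.1.1.2)
  | Sum.inr e => (Sum.inl e.1, Sum.inr e.2)

/-- `joins e C C'` means the node `e` lies in `C ∩ C'`. -/
def joins {n d k : ℕ} (e : Node n d k) (C C' : Comp d k) : Prop :=
  ends e = (C, C') ∨ ends e = (C', C)

/-- `touches e C` means the node `e` is incident to the component `C`. -/
def touches {n d k : ℕ} (e : Node n d k) (C : Comp d k) : Prop :=
  (ends e).1 = C ∨ (ends e).2 = C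

/-- The simple graph on the components obtained after deleting a set `E` of edges:
two components are adjacent if some remaining edge joins them. Its connectivity is
equivalent to connectivity of the multigraph obtained from `G(n,d,k)` by deleting `E`. -/
def remGraph (n d k : ℕ) (E : Set (Node n d k)) : SimpleGraph (Comp d k) :=
  SimpleGraph.fromRel (fun u v => ∃ e, e ∉ E ∧ ends e = (u, v))

/-- A marking `μ` (an injective tuple of nodes) is irreducible if deleting its entries
from `G(n,d,k)` leaves a connected (multi)graph. -/
def IsIrreducible {n d k r : ℕ} (μ : Fin r → Node n d k) : Prop :=
  (remGraph n d k (Set.range μ)).Connected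

/-- The intersection number `C.C'`: the number of edges between `C` and `C'`. -/
noncomputable def interNum (n d k : ℕ) (C C' : Comp d k) : ℕ :=
  Nat.card {e : Node n d k // joins e C C'}

/-- `μ_{C,C'}`: the number of entries of `μ` lying in `C ∩ C'`. -/
noncomputable def markCount {n d k r : ℕ} (μ : Fin r → Node n d k) (C C' : Comp d k) : ℕ :=
  Nat.card {i : Fin r // joins (μ i) C C'}

/-- `μ_C`: the number of entries of `μ` incident to `C`. -/
noncomputable def compCount {n d k r : ℕ} (μ : Fin r → Node n d k) (C : Comp d k) : ℕ :=
  Nat.card {i : Fin r // touches (μ i) C}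

/-- A single D-move. -/
def DMove {n d k r : ℕ} (μ μ' : Fin r → Node n d k) : Prop :=
  ∃ (D D' : Comp d k) (q q' : Node n d k),
    D ≠ D' ∧ q ≠ q' ∧ joins q D D' ∧ joins q' D D' ∧
    ( (q ∉ Set.range μ ∧ ∃ i, μ i = q' ∧ μ' = Function.update μ i q)
    ∨ (q' ∉ Set.range μ ∧ ∃ i, μ i = q ∧ μ' = Function.update μ i q')
    ∨ (∃ i j, μ i = q ∧ μ j = q' ∧ μ' = μ ∘ Equiv.swap i j)
    ∨ (q ∉ Set.range μ ∧ q' ∉ Set.range μ ∧ μ' = μ) )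

/-- A single T-move. -/
def TMove {n d k r : ℕ} (μ μ' : Fin r → Node n d k) : Prop :=
  ∃ (D D' D'' : Comp d k) (q q' q'' : Node n d k),
    D ≠ D' ∧ D ≠ D'' ∧ D' ≠ D'' ∧
    joins q D' D'' ∧ joins q' D D'' ∧ joins q'' D D' ∧
    ( (q' ∈ Set.range μ ∧ μ' = μ)
    ∨ (q' ∉ Set.range μ ∧
        ( (q'' ∉ Set.range μ ∧ ∃ i, μ i = q ∧ μ' = Function.update μ i q'')
        ∨ (q ∉ Set.range μ ∧ ∃ i, μ i = q'' ∧ μ' = Function.update μ i q)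
        ∨ (∃ i j, μ i = q ∧ μ j = q'' ∧ μ' = μ ∘ Equiv.swap i j)
        ∨ (q ∉ Set.range μ ∧ q'' ∉ Set.range μ ∧ μ' = μ))) )

/-- Equivalence of markings: a finite sequence of D-moves and T-moves. -/
def MarkEquiv {n d k r : ℕ} (μ μ' : Fin r → Node n d k) : Prop :=
  Relation.ReflTransGen (fun a b => DMove a b ∨ TMove a b) μ μ'

/-- Property (*) relative to the distinguished component `Ld`. -/
def PropertyStar {n d k r : ℕ} (Ld : Comp d k) (μ : Fin r → Node n d k) : Prop :=
  ∀ C C' : Comp d k, C ≠ C' →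
    markCount μ C C' =
      if Ld = C ∨ Ld = C' then interNum n d k C C' - 1 else interNum n d k C C'

section Exchange

variable {n d k r : ℕ}

theorem joins_symm {e : Node n d k} {C C' : Comp d k} (h : joins e C C') : joins e C' C :=
  Or.symm h

theorem joins_right_unique {e : Node n d k} {A B C : Comp d k}
    (hB : joins e A B) (hC : joins e A C) : B = C := by
  rcases hB with hB | hB <;> rcases hC with hC | hC <;> rw [hB] at hC <;> simp_all

theorem ends_fst_ne_snd (e : Node n d k) : (ends e).1 ≠ (ends e).2 := by
  rcases e with ⟨⟨p, hp⟩, i⟩ | p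
  · simpa [ends] using hp.ne
  · simp [ends]

theorem joins_ne {e : Node n d k} {C C' : Comp d k} (h : joins e C C') : C ≠ C' := by
  have := ends_fst_ne_snd e
  rcases h with h | h <;> rw [h] at this
  exacts [this, this.symm]

theorem exists_joins_of_touches {e : Node n d k} {A : Comp d k} (h : touches e A) :
    ∃ B, joins e A B := by
  rcases h with h | h
  · exact ⟨(ends e).2, Or.inl (by rw [← h])⟩
  · exact ⟨(ends e).1, Or.inr (by rw [← h])⟩

theorem swap_comp_swap_comp_swap {α β : Type*} [DecidableEq α] {x y z : α} (hxy : x ≠ y)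
    (hxz : x ≠ z) (f : β → α) :
    Equiv.swap y z ∘ Equiv.swap x y ∘ Equiv.swap y z ∘ f = Equiv.swap z x ∘ f := by
  rw [← Equiv.swap_mul_swap_mul_swap hxy hxz]
  rfl

/-- The nodes `q` and `q'` are distinct and either parallel, or two sides of a triangle whose
third side is outside `E`. -/
def Exchangeable (E : Set (Node n d k)) (q q' : Node n d k) : Prop :=
  q ≠ q' ∧ ((∃ D D', joins q D D' ∧ joins q' D D') ∨
    ∃ D D' D'' p, joins q D' D'' ∧ joins p D D'' ∧ joins q' D D' ∧ p ∉ E)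

def Exchange (μ μ' : Fin r → Node n d k) : Prop :=
  ∃ q q', Exchangeable (Set.range μ) q q' ∧ μ' = Equiv.swap q q' ∘ μ

theorem swap_comp_cases (μ : Fin r → Node n d k) (hμ : Function.Injective μ)
    (q q' : Node n d k) :
    (q ∉ Set.range μ ∧ ∃ i, μ i = q' ∧ Equiv.swap q q' ∘ μ = Function.update μ i q) ∨
    (q' ∉ Set.range μ ∧ ∃ i, μ i = q ∧ Equiv.swap q q' ∘ μ = Function.update μ i q') ∨
    (∃ i j, μ i = q ∧ μ j = q' ∧ Equiv.swap q q' ∘ μ = μ ∘ Equiv.swap i j) ∨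
    (q ∉ Set.range μ ∧ q' ∉ Set.range μ ∧ Equiv.swap q q' ∘ μ = μ) := by
  by_cases hq : q ∈ Set.range μ <;> by_cases hq' : q' ∈ Set.range μ
  · obtain ⟨i, rfl⟩ := hq
    obtain ⟨j, rfl⟩ := hq'
    exact Or.inr (Or.inr (Or.inl ⟨i, j, rfl, rfl, (hμ.swap_comp i j)⟩))
  · obtain ⟨i, rfl⟩ := hq
    refine Or.inr (Or.inl ⟨hq', i, rfl, ?_⟩)
    funext j
    have := fun h : μ j = q' => hq' ⟨j, h⟩
    have := @hμ j i
    simp only [Function.comp, Equiv.swap_apply_def, Function.update_apply]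
    grind
  · obtain ⟨i, rfl⟩ := hq'
    refine Or.inl ⟨hq, i, rfl, ?_⟩
    funext j
    have := fun h : μ j = q => hq ⟨j, h⟩
    have := @hμ j i
    simp only [Function.comp, Equiv.swap_apply_def, Function.update_apply]
    grind
  · refine Or.inr (Or.inr (Or.inr ⟨hq, hq', ?_⟩))
    funext j
    exact Equiv.swap_apply_of_ne_of_ne (fun h => hq ⟨j, h⟩) (fun h => hq' ⟨j, h⟩)

theorem Exchange.move {μ μ' : Fin r → Node n d k} (hμ : Function.Injective μ)
    (h : Exchange μ μ') : DMove μ μ' ∨ TMove μ μ' := by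
  obtain ⟨q, q', ⟨hne, ⟨D, D', h₁, h₂⟩ | ⟨D, D', D'', p, h₁, h₂, h₃, hp⟩⟩, rfl⟩ := h
  · exact Or.inl ⟨D, D', q, q', joins_ne h₁, hne, h₁, h₂, swap_comp_cases μ hμ q q'⟩
  · refine Or.inr ⟨D, D', D'', q, p, q', joins_ne h₃, joins_ne h₂, joins_ne h₁, h₁, h₂, h₃,
      Or.inr ⟨hp, ?_⟩⟩
    rcases swap_comp_cases μ hμ q q' with h | h | h | h
    exacts [Or.inr (Or.inl h), Or.inl h, Or.inr (Or.inr (Or.inl h)), Or.inr (Or.inr (Or.inr h))]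

theorem Exchange.injective {μ μ' : Fin r → Node n d k} (h : Exchange μ μ')
    (hμ : Function.Injective μ) : Function.Injective μ' := by
  obtain ⟨q, q', -, rfl⟩ := h
  exact (Equiv.injective _).comp hμ

theorem Exchange.symm {μ μ' : Fin r → Node n d k} (h : Exchange μ μ') : Exchange μ' μ := by
  obtain ⟨q, q', ⟨hne, h⟩, rfl⟩ := h
  refine ⟨q, q', ⟨hne, h.imp id ?_⟩, ?_⟩
  · rintro ⟨D, D', D'', p, h₁, h₂, h₃, hp⟩
    refine ⟨D, D', D'', p, h₁, h₂, h₃, ?_⟩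
    rintro ⟨i, hi⟩
    have hpq : p ≠ q := by
      rintro rfl
      exact joins_ne h₃ (joins_right_unique (joins_symm h₂) (joins_symm h₁))
    have hpq' : p ≠ q' := by
      rintro rfl
      exact joins_ne h₁ (joins_right_unique h₃ h₂)
    refine hp ⟨i, (Equiv.swap q q').injective ?_⟩
    rw [Equiv.swap_apply_of_ne_of_ne hpq hpq']
    exact hi
  · funext i
    simp

theorem markEquiv_of_exchange {μ μ' : Fin r → Node n d k} (hμ : Function.Injective μ)
    (h : Relation.ReflTransGen Exchange μ μ') : MarkEquiv μ μ' := by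
  induction h using Relation.ReflTransGen.head_induction_on with
  | refl => exact Relation.ReflTransGen.refl
  | head hs _ ih => exact Relation.ReflTransGen.head (hs.move hμ) (ih (hs.injective hμ))

end Exchange

section Star

variable {n d k r : ℕ} {R : Comp d k} {e : Comp d k → Node n d k}

/-- `e` selects, for each component other than `R`, a node joining it to `R`. -/
def IsStar (R : Comp d k) (e : Comp d k → Node n d k) : Prop :=
  ∀ C, C ≠ R → joins (e C) R C

theorem exists_joins_left (hn : 0 < n) {a b : Fin d} (h : a ≠ b) :
    ∃ z : Node n d k, joins z (Sum.inl a) (Sum.inl b) := by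
  rcases lt_or_gt_of_ne h with h | h
  · exact ⟨Sum.inl (⟨(a, b), h⟩, ⟨0, hn⟩), Or.inl rfl⟩
  · exact ⟨Sum.inl (⟨(b, a), h⟩, ⟨0, hn⟩), Or.inr rfl⟩

theorem exists_isStar (hn : 0 < n) (i : Fin d) [Nonempty (Node n d k)] :
    ∃ e : Comp d k → Node n d k, IsStar (Sum.inl i) e := by
  suffices h : ∀ C : Comp d k, ∃ x : Node n d k, C ≠ Sum.inl i → joins x (Sum.inl i) C from
    Classical.skolem.1 h
  intro C
  rcases C with j | j
  · by_cases h : i = j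
    · exact ⟨Classical.arbitrary _, fun h' => absurd (by rw [h]) h'⟩
    · obtain ⟨z, hz⟩ := exists_joins_left (k := k) hn h
      exact ⟨z, fun _ => hz⟩
  · exact ⟨Sum.inr (i, j), fun _ => Or.inl rfl⟩

theorem IsStar.injOn (he : IsStar R e) {A B : Comp d k} (hA : A ≠ R) (hB : B ≠ R)
    (h : e A = e B) : A = B :=
  joins_right_unique (he A hA) (h ▸ he B hB)

/-- A node `x ∈ A ∩ B` can be exchanged with the star node of `A` as soon as the star node of
`B` is unmarked. -/
theorem IsStar.exchange (he : IsStar R e) (μ : Fin r → Node n d k) {A B : Comp d k}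
    {x : Node n d k} (hA : A ≠ R) (hx : joins x A B) (hxe : x ≠ e A)
    (hB : B ≠ R → e B ∉ Set.range μ) : Exchange μ (Equiv.swap x (e A) ∘ μ) := by
  refine ⟨x, e A, ⟨hxe, ?_⟩, rfl⟩
  by_cases h : B = R
  · subst h
    exact Or.inl ⟨B, A, joins_symm hx, he A hA⟩
  · exact Or.inr ⟨R, A, B, e B, hx, he B h, he A hA, hB h⟩

/-- All star nodes are unmarked. -/
def StarFree (R : Comp d k) (e : Comp d k → Node n d k) (μ : Fin r → Node n d k) : Prop :=
  ∀ C, C ≠ R → e C ∉ Set.range μ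

theorem IsStar.swap_of_touches (he : IsStar R e) {μ : Fin r → Node n d k}
    (hμ : StarFree R e μ) {A : Comp d k} {x y : Node n d k} (hA : A ≠ R)
    (hx : ∀ C, C ≠ R → x ≠ e C) (hy : ∀ C, C ≠ R → y ≠ e C)
    (hxA : touches x A) (hyA : touches y A) :
    Relation.ReflTransGen Exchange μ (Equiv.swap x y ∘ μ) := by
  obtain ⟨B, hB⟩ := exists_joins_of_touches hxA
  obtain ⟨C, hC⟩ := exists_joins_of_touches hyA
  by_cases hxy : x = y
  · subst hxy
    simpa using Relation.ReflTransGen.refl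
  have key : ∀ (ν : Fin r → Node n d k) (z : Node n d k) (D : Comp d k), D ≠ R → D ≠ A →
      (∀ C, C ≠ R → z ≠ e C) → e D ∉ Set.range ν →
      e D ∉ Set.range (Equiv.swap z (e A) ∘ ν) := by
    rintro ν z D hD hDA hz hν ⟨i, hi⟩
    refine hν ⟨i, (Equiv.swap z (e A)).injective ?_⟩
    rw [Equiv.swap_apply_of_ne_of_ne (hz D hD).symm (fun h => hDA (he.injOn hD hA h))]
    exact hi
  have s₁ := he.exchange μ hA hB (hx A hA) (fun h => hμ B h)
  have s₂ := he.exchange (Equiv.swap x (e A) ∘ μ) hA hC (hy A hA)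
    (fun h => key _ _ _ h (joins_ne hC).symm hx (hμ C h))
  have s₃ := he.exchange (Equiv.swap y (e A) ∘ Equiv.swap x (e A) ∘ μ) hA hB (hx A hA)
    (fun h => key _ _ _ h (joins_ne hB).symm hy
      (key _ _ _ h (joins_ne hB).symm hx (hμ B h)))
  have heq : Equiv.swap x y ∘ μ =
      Equiv.swap x (e A) ∘ Equiv.swap y (e A) ∘ Equiv.swap x (e A) ∘ μ := by
    rw [Equiv.swap_comm x (e A), swap_comp_swap_comp_swap (hy A hA) (Ne.symm hxy)]
  rw [heq]
  exact ((Relation.ReflTransGen.single s₁).tail s₂).tail s₃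

theorem StarFree.swap {μ : Fin r → Node n d k} (hμ : StarFree R e μ) {x y : Node n d k}
    (hx : ∀ C, C ≠ R → x ≠ e C) (hy : ∀ C, C ≠ R → y ≠ e C) :
    StarFree R e (Equiv.swap x y ∘ μ) := by
  rintro C hC ⟨i, hi⟩
  refine hμ C hC ⟨i, (Equiv.swap x y).injective ?_⟩
  rw [Equiv.swap_apply_of_ne_of_ne (hx C hC).symm (hy C hC).symm]
  exact hi

/-- Every node outside the star touches some `L_j` other than the centre. -/
theorem IsStar.touches_left {i : Fin d} (he : IsStar (Sum.inl i) e) {x : Node n d k}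
    (hx : ∀ C, C ≠ Sum.inl i → x ≠ e C) : ∃ j, j ≠ i ∧ touches x (Sum.inl j) := by
  rcases x with ⟨⟨⟨a, b⟩, hab⟩, m⟩ | ⟨a, b⟩
  · by_cases h : a = i
    · exact ⟨b, fun h' => absurd hab (by simp [h, h']), Or.inr rfl⟩
    · exact ⟨a, h, Or.inl rfl⟩
  · refine ⟨a, ?_, Or.inl rfl⟩
    rintro rfl
    refine hx (Sum.inr b) (by simp) ?_
    have := he (Sum.inr b) (by simp)
    generalize e (Sum.inr b) = z at this
    rcases z with ⟨⟨⟨a', b'⟩, _⟩, m⟩ | ⟨a', b'⟩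
    · simp [joins, ends] at this
    · simp only [joins, ends, Prod.mk.injEq, Sum.inl.injEq, Sum.inr.injEq, reduceCtorEq,
        false_and, or_false] at this
      rw [this.1, this.2]

theorem IsStar.swap_mem {i : Fin d} (hn : 0 < n) (he : IsStar (Sum.inl i) e)
    {μ : Fin r → Node n d k} (hμ : StarFree (Sum.inl i) e μ) {x y : Node n d k}
    (hx : ∀ C, C ≠ Sum.inl i → x ≠ e C) (hy : ∀ C, C ≠ Sum.inl i → y ≠ e C) :
    Relation.ReflTransGen Exchange μ (Equiv.swap x y ∘ μ) := by
  obtain ⟨a, ha, hxa⟩ := he.touches_left hx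
  obtain ⟨b, hb, hyb⟩ := he.touches_left hy
  have hA : (Sum.inl a : Comp d k) ≠ Sum.inl i := by simpa using ha
  have hB : (Sum.inl b : Comp d k) ≠ Sum.inl i := by simpa using hb
  by_cases hab : a = b
  · subst hab
    exact he.swap_of_touches hμ hA hx hy hxa hyb
  by_cases hxy : x = y
  · subst hxy
    simpa using Relation.ReflTransGen.refl
  obtain ⟨z, hz⟩ := exists_joins_left (n := n) (k := k) hn hab
  have hza : touches z (Sum.inl a : Comp d k) := by
    rcases hz with h | h <;> simp [touches, h]
  have hzb : touches z (Sum.inl b : Comp d k) := by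
    rcases hz with h | h <;> simp [touches, h]
  have hzS : ∀ C, C ≠ Sum.inl i → z ≠ e C := by
    rintro C hC rfl
    have h := he C hC
    rcases hz with h' | h' <;> rcases h with h | h <;> rw [h] at h' <;> simp_all
  by_cases hxz : x = z
  · subst hxz
    exact he.swap_of_touches hμ hB hx hy hzb hyb
  have s₁ := he.swap_of_touches hμ hB hzS hy hzb hyb
  have s₂ := he.swap_of_touches (hμ.swap hzS hy) hA hx hzS hxa hza
  have s₃ := he.swap_of_touches ((hμ.swap hzS hy).swap hx hzS) hB hzS hy hzb hyb
  have heq : Equiv.swap x y ∘ μ =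
      Equiv.swap z y ∘ Equiv.swap x z ∘ Equiv.swap z y ∘ μ := by
    rw [Equiv.swap_comm x y, swap_comp_swap_comp_swap hxz hxy]
  rw [heq]
  exact (s₁.trans s₂).trans s₃

theorem IsStar.equiv_of_starFree {i : Fin d} (hn : 0 < n) (he : IsStar (Sum.inl i) e)
    {μ μ' : Fin r → Node n d k} (hμ : Function.Injective μ) (hμ' : Function.Injective μ')
    (h : StarFree (Sum.inl i) e μ) (h' : StarFree (Sum.inl i) e μ') :
    Relation.ReflTransGen Exchange μ μ' := by
  let N := {x : Node n d k // ∀ C, C ≠ Sum.inl i → x ≠ e C}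
  have lift : ∀ ν : Fin r → Node n d k, StarFree (Sum.inl i) e ν → ∀ j, ∀ C, C ≠ Sum.inl i →
      ν j ≠ e C := fun ν hν j C hC hj => hν C hC ⟨j, hj⟩
  let f : Fin r ↪ N := ⟨fun j => ⟨μ j, lift μ h j⟩, fun a b hab => hμ (congrArg Subtype.val hab)⟩
  let g : Fin r ↪ N :=
    ⟨fun j => ⟨μ' j, lift μ' h' j⟩, fun a b hab => hμ' (congrArg Subtype.val hab)⟩
  obtain ⟨σ, hσ⟩ := (Equiv.Perm.isMultiplyPretransitive N r).exists_smul_eq f g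
  have main : ∀ (τ : Equiv.Perm N),
      Relation.ReflTransGen Exchange μ (fun j => (τ (f j)).1) := by
    intro τ
    induction τ using Equiv.Perm.swap_induction_on with
    | one => exact Relation.ReflTransGen.refl
    | swap_mul τ x y hxy ih =>
      refine ih.trans ?_
      convert he.swap_mem hn (μ := fun j => (τ (f j)).1) ?_ x.2 y.2 using 1
      · funext j
        exact (Subtype.val_injective.swap_apply x y (τ (f j))).symm
      · rintro C hC ⟨j, hj⟩
        exact (τ (f j)).2 C hC hj
  convert main σ using 1
  funext j
  have := congrArg (fun F : Fin r ↪ N => (F j).1) hσ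
  exact this.symm

theorem remGraph_adj_iff {E : Set (Node n d k)} {u v : Comp d k} :
    (remGraph n d k E).Adj u v ↔ ∃ x, x ∉ E ∧ joins x u v := by
  simp only [remGraph, SimpleGraph.fromRel_adj, joins]
  constructor
  · rintro ⟨-, ⟨x, hx, h⟩ | ⟨x, hx, h⟩⟩
    exacts [⟨x, hx, Or.inl h⟩, ⟨x, hx, Or.inr h⟩]
  · rintro ⟨x, hx, h⟩
    exact ⟨joins_ne h, h.imp (fun h => ⟨x, hx, h⟩) (fun h => ⟨x, hx, h⟩)⟩

theorem connected_of_reachable {V : Type*} {G H : SimpleGraph V} (hG : G.Connected)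
    (h : ∀ u v, G.Adj u v → H.Reachable u v) : H.Connected := by
  have := hG.nonempty
  refine ⟨fun u v => ?_⟩
  obtain ⟨p⟩ := hG.preconnected u v
  induction p with
  | nil => exact SimpleGraph.Reachable.refl _
  | cons hadj _ ih => exact (h _ _ hadj).trans ih

/-- In a connected graph, some edge leaves any proper vertex set containing a given vertex. -/
theorem exists_adj_boundary {V : Type*} {G : SimpleGraph V} (hG : G.Connected) (X : Set V)
    {u v : V} (hu : u ∈ X) (hv : v ∉ X) : ∃ a b, a ∈ X ∧ b ∉ X ∧ G.Adj a b := by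
  obtain ⟨p⟩ := hG.preconnected u v
  obtain ⟨D, -, h₁, h₂⟩ := p.exists_boundary_dart X hu hv
  exact ⟨_, _, h₁, h₂, D.adj⟩

theorem IsStar.exists_starFree (he : IsStar R e) (μ : Fin r → Node n d k)
    (h : IsIrreducible μ) :
    ∃ ν, Relation.ReflTransGen Exchange μ ν ∧ StarFree R e ν := by
  classical
  induction hm : (Finset.univ.filter fun C => C ≠ R ∧ e C ∈ Set.range μ).card
    using Nat.strong_induction_on generalizing μ with
  | _ m ih =>
  by_cases hfree : StarFree R e μ
  · exact ⟨μ, Relation.ReflTransGen.refl, hfree⟩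
  simp only [StarFree, not_forall, not_not] at hfree
  obtain ⟨C, hC, hCμ⟩ := hfree
  obtain ⟨A, B, hA, hB, hAB⟩ := exists_adj_boundary h {C | C ≠ R → e C ∉ Set.range μ}
    (u := R) (v := C) (fun h => absurd rfl h) (by simpa using ⟨hC, hCμ⟩)
  simp only [Set.mem_ofPred_eq, Classical.not_imp, not_not] at hA hB
  obtain ⟨hBR, hBμ⟩ := hB
  obtain ⟨y, hy, hyAB⟩ := remGraph_adj_iff.1 hAB
  have hye : y ≠ e B := fun h => hy (h ▸ hBμ)
  have step := he.exchange μ hBR (joins_symm hyAB) hye hA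
  have hrange : ∀ z, z ≠ y → z ∉ Set.range μ →
      z ∉ Set.range (Equiv.swap y (e B) ∘ μ) := by
    rintro z hzy hz ⟨i, hi⟩
    refine hz ⟨i, (Equiv.swap y (e B)).injective ?_⟩
    rw [Equiv.swap_apply_of_ne_of_ne hzy (fun h => hz (h ▸ hBμ))]
    exact hi
  have hyD : ∀ D, D ≠ R → y ≠ e D := by
    rintro D hD rfl
    have h := he D hD
    have hDB : D ≠ B := fun h => hye (by rw [h])
    rcases h with h | h <;> rcases hyAB with h' | h' <;> rw [h] at h' <;> simp_all
  have heB : e B ∉ Set.range (Equiv.swap y (e B) ∘ μ) := by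
    rintro ⟨i, hi⟩
    refine hy ⟨i, (Equiv.swap y (e B)).injective ?_⟩
    rw [Equiv.swap_apply_left]
    exact hi
  have hirr : IsIrreducible (Equiv.swap y (e B) ∘ μ) := by
    refine connected_of_reachable h fun u v huv => ?_
    obtain ⟨z, hz, hzuv⟩ := remGraph_adj_iff.1 huv
    by_cases hzy : z = y
    · subst hzy
      have hRB : (remGraph n d k (Set.range (Equiv.swap z (e B) ∘ μ))).Reachable R B :=
        (remGraph_adj_iff.2 ⟨e B, heB, he B hBR⟩).reachable
      have hRA : (remGraph n d k (Set.range (Equiv.swap z (e B) ∘ μ))).Reachable R A := by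
        by_cases hAR : A = R
        · rw [hAR]
        · exact (remGraph_adj_iff.2
            ⟨e A, hrange _ (hyD A hAR).symm (hA hAR), he A hAR⟩).reachable
      have hABr := hRA.symm.trans hRB
      rcases hzuv with h | h <;> rcases hyAB with h' | h' <;> rw [h] at h' <;>
        obtain ⟨rfl, rfl⟩ := Prod.mk.inj h'
      exacts [hABr, hABr.symm, hABr.symm, hABr]
    · exact (remGraph_adj_iff.2 ⟨z, hrange z hzy hz, hzuv⟩).reachable
  obtain ⟨ν, hν, hνfree⟩ := ih _ (by
    rw [← hm]
    refine Finset.card_lt_card (Finset.ssubset_iff_of_subset ?_ |>.2 ⟨B, ?_, ?_⟩)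
    · intro D hD
      simp only [Finset.mem_filter, Finset.mem_univ, true_and] at hD ⊢
      exact ⟨hD.1, by_contra fun hn => hrange _ (hyD D hD.1).symm hn hD.2⟩
    · simpa using ⟨hBR, hBμ⟩
    · simp only [Finset.mem_filter, Finset.mem_univ, true_and, not_and]
      exact fun _ => heB) _ hirr rfl
  exact ⟨ν, Relation.ReflTransGen.head step hν, hνfree⟩

end Star

/-- Lemma 4 of the paper. Assume `n > 0`. Then any two irreducible
`r`-markings on the curve `Γ` are equivalent, i.e., one can be obtained from the other
by a finite sequence of D-moves and T-moves. -/
theorem stmt1 (n d k r : ℕ) (hn : 0 < n) (hd : 0 < d)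
    (μ μ' : Fin r → Node n d k)
    (hμ : Function.Injective μ) (hμ' : Function.Injective μ')
    (h1 : IsIrreducible μ) (h2 : IsIrreducible μ') :
    MarkEquiv μ μ' := by
  by_cases hN : Nonempty (Node n d k)
  · obtain ⟨e, he⟩ := exists_isStar (k := k) hn ⟨0, hd⟩
    obtain ⟨ν, hν, hνfree⟩ := he.exists_starFree μ h1
    obtain ⟨ν', hν', hνfree'⟩ := he.exists_starFree μ' h2
    have inj : ∀ {α β : Fin r → Node n d k}, Relation.ReflTransGen Exchange α β →
        Function.Injective α → Function.Injective β := fun h hα => by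
      induction h with
      | refl => exact hα
      | tail _ hs ih => exact hs.injective ih
    refine markEquiv_of_exchange hμ ((hν.trans
      (he.equiv_of_starFree hn (inj hν hμ) (inj hν' hμ') hνfree hνfree')).trans ?_)
    have : Std.Symm (Exchange (n := n) (d := d) (k := k) (r := r)) := ⟨fun _ _ => Exchange.symm⟩
    exact Relation.ReflTransGen.stdSymm.symm _ _ hν'
  · have : μ = μ' := funext fun j => absurd ⟨μ j⟩ hN
    exact this ▸ Relation.ReflTransGen.refl

end SeveriMarkings
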